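/- Let d be a positive integer, σ > 0, s_max > 0, let V_0 be a real symmetric positive definite d×d matrix, and for each n = 1, …, N let z_{n,1}, …, z_{n,K_n} ∈ ℝ^d; define recursively V_n = V_{n-1} + σ^{-2} Σ_{k=1}^{K_n} z_{n,k} z_{n,k}ᵀ, and set a_n := σ^{-2} Σ_{k=1}^{K_n} z_{n,k}ᵀ V_{n-1}^{-1} z_{n,k}. If a_n ≤ s_max for every n ∈ {1,…,N}, then Σ_{n=1}^N a_n ≤ (s_max / log(1 + s_max)) · log(det V_N / det V_0). -/

import Mathlib

open Matrix

theorem Finset.one_add_sum_le_prod_one_add {ι : Type*} (s : Finset ι) {f : ι → ℝ}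
    (hf : ∀ i ∈ s, 0 ≤ f i) : 1 + ∑ i ∈ s, f i ≤ ∏ i ∈ s, (1 + f i) := by
  classical
  induction s using Finset.induction_on with
  | empty => simp
  | insert i s hi ih =>
    rw [Finset.sum_insert hi, Finset.prod_insert hi]
    have hi0 := hf i (Finset.mem_insert_self i s)
    have hs : ∀ j ∈ s, 0 ≤ f j := fun j hj => hf j (Finset.mem_insert_of_mem hj)
    nlinarith [ih hs, Finset.sum_nonneg hs, mul_nonneg hi0 (Finset.sum_nonneg hs)]

theorem Matrix.IsHermitian.det_one_add_eq_prod {n : Type*} [Fintype n] [DecidableEq n]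
    {A : Matrix n n ℝ} (hA : A.IsHermitian) :
    (1 + A).det = ∏ i, (1 + hA.eigenvalues i) := by
  have h := congrArg (Polynomial.eval (-1)) hA.charpoly_eq
  rw [Matrix.eval_charpoly, Polynomial.eval_prod] at h
  have hneg : Matrix.scalar n (-1 : ℝ) - A = -(1 + A) := by
    rw [map_neg, map_one]
    abel
  have hfactor : ∀ i, Polynomial.eval (-1 : ℝ)
      (Polynomial.X - Polynomial.C ((hA.eigenvalues i : ℝ))) = -(1 + hA.eigenvalues i) := by
    intro i
    simp only [Polynomial.eval_sub, Polynomial.eval_X, Polynomial.eval_C]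
    ring
  simp only [RCLike.ofReal_real_eq_id, id_eq, hfactor] at h
  rw [hneg, Matrix.det_neg, Finset.prod_neg, Finset.card_univ] at h
  exact mul_left_cancel₀ (pow_ne_zero _ (by norm_num)) h

theorem Matrix.PosSemidef.one_add_trace_le_det_one_add {n : Type*} [Fintype n] [DecidableEq n]
    {A : Matrix n n ℝ} (hA : A.PosSemidef) : 1 + A.trace ≤ (1 + A).det := by
  rw [hA.isHermitian.det_one_add_eq_prod, hA.isHermitian.trace_eq_sum_eigenvalues]
  exact Finset.one_add_sum_le_prod_one_add _ fun i _ => hA.eigenvalues_nonneg i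

/-- A batch of rank-one updates multiplies the determinant by at least one plus the sum of the
corresponding quadratic forms of the inverse. -/
theorem Matrix.PosDef.det_mul_one_add_le_det_add_sum_vecMulVec {m ι : Type*} [Fintype m]
    [DecidableEq m] [Fintype ι] {V : Matrix m m ℝ} (hV : V.PosDef) {c : ℝ} (hc : 0 ≤ c)
    (z : ι → m → ℝ) :
    V.det * (1 + c * ∑ k, z k ⬝ᵥ (V⁻¹ *ᵥ z k)) ≤
      (V + c • ∑ k, vecMulVec (z k) (z k)).det := by
  classical
  let Z : Matrix ι m ℝ := Matrix.of z
  have hsum : c • ∑ k, vecMulVec (z k) (z k) = Zᵀ * (c • Z) := by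
    ext i j
    simp [Z, Matrix.mul_apply, Matrix.sum_apply, vecMulVec_apply, Finset.mul_sum,
      mul_left_comm]
  have hpsd : (c • Z * V⁻¹ * Zᵀ).PosSemidef := by
    have h := (hV.inv.posSemidef.mul_mul_conjTranspose_same Z).smul hc
    simpa [Matrix.smul_mul, Matrix.conjTranspose_eq_transpose_of_trivial] using h
  have htrace : (c • Z * V⁻¹ * Zᵀ).trace = c * ∑ k, z k ⬝ᵥ (V⁻¹ *ᵥ z k) := by
    rw [Matrix.smul_mul, Matrix.smul_mul, Matrix.trace_smul, smul_eq_mul, Matrix.mul_assoc]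
    rfl
  rw [hsum, Matrix.det_add_mul _ _ hV.det_pos.ne'.isUnit, ← htrace]
  exact mul_le_mul_of_nonneg_left hpsd.one_add_trace_le_det_one_add hV.det_pos.le

theorem Matrix.PosDef.add_smul_sum_vecMulVec {m ι : Type*} [Fintype m] [Fintype ι]
    {V : Matrix m m ℝ} (hV : V.PosDef) {c : ℝ} (hc : 0 ≤ c) (z : ι → m → ℝ) :
    (V + c • ∑ k, vecMulVec (z k) (z k)).PosDef :=
  hV.add_posSemidef ((Matrix.posSemidef_sum _ fun k _ => by
    simpa using posSemidef_vecMulVec_self_star (z k)).smul hc)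

theorem Real.le_div_log_mul_log_one_add {s t : ℝ} (hs : 0 ≤ s) (hst : s ≤ t) (ht : 0 < t) :
    s ≤ t / Real.log (1 + t) * Real.log (1 + s) := by
  have hlog : 0 < Real.log (1 + t) := Real.log_pos (by linarith)
  have hbern := rpow_one_add_le_one_add_mul_self (s := t) (by linarith)
    (div_nonneg hs ht.le) ((div_le_one ht).2 hst)
  rw [div_mul_cancel₀ _ ht.ne'] at hbern
  have h := Real.log_le_log (by positivity) hbern
  rw [Real.log_rpow (by linarith), div_mul_eq_mul_div, div_le_iff₀ ht] at h
  rw [div_mul_eq_mul_div, le_div_iff₀ hlog]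
  linarith

/-- Episode-level potential bound: with `V (n+1) = V n + σ⁻² ∑ₖ z n k (z n k)ᵀ` starting
from a symmetric positive definite `V 0`, and
`a n = σ⁻² ∑ₖ (z n k)ᵀ (V n)⁻¹ (z n k)`, if `a n ≤ s_max` for every episode, then
`∑ₙ a n ≤ (s_max / log (1 + s_max)) · log (det (V N) / det (V 0))`. -/
theorem sum_quadratic_le_info_gain
    (d N : ℕ) (hd : 0 < d) (σ : ℝ) (hσ : 0 < σ) (smax : ℝ) (hsmax : 0 < smax)
    (K : ℕ → ℕ) (z : (n : ℕ) → Fin (K n) → (Fin d → ℝ))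
    (V : ℕ → Matrix (Fin d) (Fin d) ℝ)
    (hV0 : (V 0).PosDef)
    (hrec : ∀ n < N,
      V (n + 1) = V n + (σ ^ 2)⁻¹ • ∑ k, vecMulVec (z n k) (z n k))
    (a : ℕ → ℝ)
    (ha : ∀ n < N, a n = (σ ^ 2)⁻¹ * ∑ k, z n k ⬝ᵥ ((V n)⁻¹ *ᵥ z n k))
    (hbound : ∀ n < N, a n ≤ smax) :
    ∑ n ∈ Finset.range N, a n
      ≤ (smax / Real.log (1 + smax)) * Real.log ((V N).det / (V 0).det) := by
  have hc : 0 ≤ (σ ^ 2)⁻¹ := by positivity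
  have hpos : ∀ n ≤ N, (V n).PosDef := by
    intro n
    induction n with
    | zero => exact fun _ => hV0
    | succ n ih =>
      intro hn
      rw [hrec n hn]
      exact (ih (Nat.le_of_lt hn)).add_smul_sum_vecMulVec hc (z n)
  have hstep : ∀ n < N, a n ≤ smax / Real.log (1 + smax) *
      (Real.log (V (n + 1)).det - Real.log (V n).det) := by
    intro n hn
    have hVn := hpos n hn.le
    have ha0 : 0 ≤ a n := by
      rw [ha n hn]
      exact mul_nonneg hc (Finset.sum_nonneg fun k _ => by
        simpa using hVn.inv.posSemidef.dotProduct_mulVec_nonneg (z n k))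
    refine (Real.le_div_log_mul_log_one_add ha0 (hbound n hn) hsmax).trans ?_
    have hdet := hVn.det_mul_one_add_le_det_add_sum_vecMulVec hc (z n)
    rw [← ha n hn, ← hrec n hn] at hdet
    have hlog := Real.log_le_log (mul_pos hVn.det_pos (by linarith)) hdet
    rw [Real.log_mul hVn.det_pos.ne' (by linarith)] at hlog
    exact mul_le_mul_of_nonneg_left (by linarith)
      (div_nonneg hsmax.le (Real.log_nonneg (by linarith)))
  calc ∑ n ∈ Finset.range N, a n
      ≤ ∑ n ∈ Finset.range N, smax / Real.log (1 + smax) *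
          (Real.log (V (n + 1)).det - Real.log (V n).det) :=
        Finset.sum_le_sum fun n hn => hstep n (Finset.mem_range.1 hn)
    _ = smax / Real.log (1 + smax) * Real.log ((V N).det / (V 0).det) := by
        rw [← Finset.mul_sum, Finset.sum_range_sub fun n => Real.log (V n).det,
          Real.log_div (hpos N le_rfl).det_pos.ne' hV0.det_pos.ne']
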